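/- Let Z be an integrable real-valued random variable and let p ∈ (0,1). Then the infimum in the Rockafellar–Uryasev characterization of the superquantile is attained at η = Q_Z(p), i.e., S̄_p[Z] = Q_Z(p) + (1/(1−p))·E[max(Z − Q_Z(p), 0)]. -/

import Mathlib

open MeasureTheory

/-- The cumulative distribution function `F_Z(t) = P(Z ≤ t)` of a random variable `Z`. -/
noncomputable def cdfRV {Ω : Type*} [MeasurableSpace Ω] (μ : Measure Ω) (Z : Ω → ℝ) (t : ℝ) : ℝ :=
  (μ {ω | Z ω ≤ t}).toReal

/-- The quantile function `Q_Z(u) = inf {t : F_Z(t) ≥ u}` of a random variable `Z`. -/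
noncomputable def quantileRV {Ω : Type*} [MeasurableSpace Ω] (μ : Measure Ω) (Z : Ω → ℝ)
    (u : ℝ) : ℝ :=
  sInf {t : ℝ | u ≤ cdfRV μ Z t}

open ProbabilityTheory

lemma cdfRV_eq {Ω : Type*} [MeasurableSpace Ω] (μ : Measure Ω)
    [IsProbabilityMeasure μ] (Z : Ω → ℝ) (hZ : Measurable Z) (t : ℝ) :
    cdfRV μ Z t = cdf (μ.map Z) t := by
  haveI : IsProbabilityMeasure (μ.map Z) := Measure.isProbabilityMeasure_map hZ.aemeasurable
  rw [cdf_eq_real, Measure.real, Measure.map_apply hZ measurableSet_Iic]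
  rfl

lemma quantileRV_le_iff {Ω : Type*} [MeasurableSpace Ω] (μ : Measure Ω)
    [IsProbabilityMeasure μ] (Z : Ω → ℝ) (hZ : Measurable Z) {u : ℝ}
    (hu : u ∈ Set.Ioo (0 : ℝ) 1) (t : ℝ) :
    quantileRV μ Z u ≤ t ↔ u ≤ cdfRV μ Z t := by
  have hmono : Monotone (cdfRV μ Z) := fun a b h => by
    rw [cdfRV_eq μ Z hZ, cdfRV_eq μ Z hZ]; exact monotone_cdf _ h
  have hbdd : BddBelow {t : ℝ | u ≤ cdfRV μ Z t} := by
    obtain ⟨a, ha⟩ := ((tendsto_cdf_atBot (μ.map Z)).eventually_lt_const hu.1).exists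
    refine ⟨a, fun t ht => ?_⟩
    by_contra h
    push Not at h
    have := hmono h.le
    rw [cdfRV_eq μ Z hZ a] at this
    exact absurd (lt_of_le_of_lt (le_trans ht this) ha) (lt_irrefl _)
  have hne : {t : ℝ | u ≤ cdfRV μ Z t}.Nonempty := by
    obtain ⟨a, ha⟩ := ((tendsto_cdf_atTop (μ.map Z)).eventually_const_lt hu.2).exists
    exact ⟨a, by rw [Set.mem_setOf_eq, cdfRV_eq μ Z hZ a]; exact ha.le⟩
  constructor
  · intro h
    have hrc := (cdf (μ.map Z)).right_continuous t
    have hrc' : Filter.Tendsto (cdf (μ.map Z)) (nhdsWithin t (Set.Ioi t))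
        (nhds (cdf (μ.map Z) t)) := hrc.mono_left (nhdsWithin_mono _ Set.Ioi_subset_Ici_self)
    rw [cdfRV_eq μ Z hZ]
    refine ge_of_tendsto hrc' ?_
    filter_upwards [self_mem_nhdsWithin] with s hs
    obtain ⟨r, hr, hrs⟩ := exists_lt_of_csInf_lt hne (lt_of_le_of_lt h hs)
    rw [← cdfRV_eq μ Z hZ]
    exact le_trans hr (hmono hrs.le)
  · intro h
    exact csInf_le hbdd h

lemma quantileRV_monoOn {Ω : Type*} [MeasurableSpace Ω] (μ : Measure Ω)
    [IsProbabilityMeasure μ] (Z : Ω → ℝ) (hZ : Measurable Z) :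
    MonotoneOn (quantileRV μ Z) (Set.Ioo (0 : ℝ) 1) := by
  intro a ha b hb hab
  rw [quantileRV_le_iff μ Z hZ ha]
  exact hab.trans ((quantileRV_le_iff μ Z hZ hb _).1 le_rfl)

lemma quantileRV_aemeasurable {Ω : Type*} [MeasurableSpace Ω] (μ : Measure Ω)
    [IsProbabilityMeasure μ] (Z : Ω → ℝ) (hZ : Measurable Z) :
    AEMeasurable (quantileRV μ Z) (volume.restrict (Set.Ioo (0 : ℝ) 1)) :=
  aemeasurable_restrict_of_monotoneOn measurableSet_Ioo (quantileRV_monoOn μ Z hZ)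

lemma map_quantileRV {Ω : Type*} [MeasurableSpace Ω] (μ : Measure Ω)
    [IsProbabilityMeasure μ] (Z : Ω → ℝ) (hZ : Measurable Z) :
    (volume.restrict (Set.Ioo (0 : ℝ) 1)).map (quantileRV μ Z) = μ.map Z := by
  have hm := quantileRV_aemeasurable μ Z hZ
  haveI : IsProbabilityMeasure (μ.map Z) := Measure.isProbabilityMeasure_map hZ.aemeasurable
  haveI : IsFiniteMeasure ((volume.restrict (Set.Ioo (0 : ℝ) 1)).map (quantileRV μ Z)) :=
    inferInstance
  refine Measure.ext_of_Iic _ _ fun t => ?_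
  rw [Measure.map_apply_of_aemeasurable hm measurableSet_Iic, ← ofReal_cdf,
    ← cdfRV_eq μ Z hZ]
  have h1 : cdfRV μ Z t ≤ 1 := by rw [cdfRV_eq μ Z hZ]; exact cdf_le_one _ _
  have : (quantileRV μ Z ⁻¹' Set.Iic t) =ᵐ[volume.restrict (Set.Ioo (0 : ℝ) 1)]
      Set.Iic (cdfRV μ Z t) := by
    filter_upwards [ae_restrict_mem measurableSet_Ioo] with u hu
    exact propext (quantileRV_le_iff μ Z hZ hu t)
  rw [measure_congr this, restrict_Ioo_eq_restrict_Ioc, Measure.restrict_apply measurableSet_Iic,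
    Set.inter_comm, Set.Ioc_inter_Iic, min_eq_right h1, Real.volume_Ioc, sub_zero]

/-- The infimum in the Rockafellar–Uryasev characterization of the superquantile is attained
at `η = Q_Z(p)`: `S̄_p[Z] = Q_Z(p) + (1/(1−p))·E[max(Z − Q_Z(p), 0)]`. -/
theorem superquantile_attained {Ω : Type*} [MeasurableSpace Ω] (μ : Measure Ω)
    [IsProbabilityMeasure μ] (Z : Ω → ℝ) (hZ : Measurable Z) (hZint : Integrable Z μ)
    (p : ℝ) (hp : p ∈ Set.Ioo (0 : ℝ) 1) :
    (1 / (1 - p)) * ∫ u in p..(1 : ℝ), quantileRV μ Z u =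
      quantileRV μ Z p + (1 / (1 - p)) * ∫ ω, max (Z ω - quantileRV μ Z p) 0 ∂μ := by
  have hm := quantileRV_aemeasurable μ Z hZ
  have hmap := map_quantileRV μ Z hZ
  have hmono := quantileRV_monoOn μ Z hZ
  set q := quantileRV μ Z p with hq
  have hQint : IntegrableOn (quantileRV μ Z) (Set.Ioo (0 : ℝ) 1) := by
    have h1 : Integrable (fun x : ℝ => x) (μ.map Z) :=
      (integrable_map_measure (by fun_prop) hZ.aemeasurable).2 hZint
    rw [← hmap] at h1
    exact (integrable_map_measure (by fun_prop) hm).1 h1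
  have hE : ∫ ω, max (Z ω - q) 0 ∂μ =
      ∫ u in Set.Ioo (0 : ℝ) 1, max (quantileRV μ Z u - q) 0 := by
    have hc : Continuous (fun x : ℝ => max (x - q) 0) := by fun_prop
    rw [← integral_map (f := fun x : ℝ => max (x - q) 0) hZ.aemeasurable
        hc.aestronglyMeasurable,
      ← integral_map (f := fun x : ℝ => max (x - q) 0) hm hc.aestronglyMeasurable, hmap]
  have hsub : Set.Ioo p 1 ⊆ Set.Ioo (0 : ℝ) 1 := Set.Ioo_subset_Ioo_left hp.1.le
  have h2 : ∫ u in Set.Ioo (0 : ℝ) 1, max (quantileRV μ Z u - q) 0 =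
      ∫ u in Set.Ioo p 1, (quantileRV μ Z u - q) := by
    rw [setIntegral_eq_of_subset_of_forall_sdiff_eq_zero measurableSet_Ioo hsub]
    · refine setIntegral_congr_fun measurableSet_Ioo fun u hu => ?_
      exact max_eq_left (sub_nonneg.2 (hmono hp (hsub hu) hu.1.le))
    · intro u hu
      have hup : u ≤ p := by
        by_contra h
        exact hu.2 ⟨not_le.1 h, hu.1.2⟩
      exact max_eq_right (sub_nonpos.2 (hmono hu.1 hp hup))
  have h3 : ∫ u in Set.Ioo p 1, (quantileRV μ Z u - q) =
      (∫ u in Set.Ioo p 1, quantileRV μ Z u) - (1 - p) * q := by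
    rw [integral_sub (hQint.mono_set hsub) (integrable_const _)]
    simp [Measure.real, hp.2.le]
  rw [hE, h2, h3, intervalIntegral.integral_of_le hp.2.le, integral_Ioc_eq_integral_Ioo]
  have : 1 - p ≠ 0 := by linarith [hp.2]
  field_simp
  ring
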